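/- Let ν = (ν_1 > ⋯ > ν_r > 0) be a strict partition of length r ≤ n and define the factorial Schur P-polynomial P_ν(x_n|b) := Σ_{w∈C(r,n)} w·( ∏_{i=1}^{r} ∏_{j=1}^{ν_i} (x_i + b_j) · ∏_{i=1}^{r} ∏_{j=i+1}^{n} (x_i + x_j)/(x_i − x_j) ). Then P_ν(x_n|b) = [u_1^{−ν_1}⋯u_r^{−ν_r}]( ∏_{i=1}^{r} (1/2)·( ∏_{j=1}^{n} (u_i + x_j)/(u_i − x_j) − (−1)^n ∏_{j=1}^{i−1} (u_i + u_j)/(u_j − u_i) ) · ∏_{1≤i<j≤r} (u_j − u_i)/(u_j + u_i) · ∏_{i=1}^{r} ∏_{j=1}^{ν_i} (u_i + b_j)/u_i ), the coefficient being taken in Λ. This is the additive specialization of the generating-function theorem for the universal factorial Schur P-functions. -/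

import Mathlib

open Finset

noncomputable section

instance finWF (r : ℕ) : WellFoundedLT (Fin r) :=
  inferInstanceAs (IsWellFounded (Fin r) (· < ·))

/-- The field `ℚ(x_1, …, x_n, b_1, b_2, …)` of rational functions. -/
abbrev K (n : ℕ) : Type := FractionRing (MvPolynomial (Fin n ⊕ ℕ) ℚ)

/-- The indeterminate `x_i` (`0`-indexed). -/
def x (n : ℕ) (i : Fin n) : K n :=
  algebraMap (MvPolynomial (Fin n ⊕ ℕ) ℚ) (K n) (MvPolynomial.X (Sum.inl i))

/-- The indeterminate `b_{j+1}` (so `b 0 = b_1`, …). -/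
def b (n : ℕ) (j : ℕ) : K n :=
  algebraMap (MvPolynomial (Fin n ⊕ ℕ) ℚ) (K n) (MvPolynomial.X (Sum.inr j))

/-- The coset representatives `C(r,n)`. -/
def Cperm (r n : ℕ) : Finset (Equiv.Perm (Fin n)) :=
  Finset.univ.filter fun w => ∀ i j : Fin n, r ≤ (i : ℕ) → i < j → w i < w j

/-- The iterated formal Laurent series field `Λ = K((u_1⁻¹))⋯((u_r⁻¹))`, realized inside the
Hahn series field over the lexicographically ordered group `ℤ^r`. -/
abbrev H (n r : ℕ) := HahnSeries (Lex (Fin r → ℤ)) (K n)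

/-- The variable `u_i` (`0`-indexed). -/
def u (n r : ℕ) (i : Fin r) : H n r :=
  HahnSeries.single (toLex (Pi.single (Fin.rev i) (-1 : ℤ))) 1

/-! ### Hahn series supported in a submonoid -/

/-- The Hahn series with support in an additive submonoid `M`. -/
def supportSubring {Γ F : Type*} [AddCommGroup Γ] [LinearOrder Γ] [IsOrderedAddMonoid Γ] [Field F]
    (M : AddSubmonoid Γ) : Subring (HahnSeries Γ F) where
  carrier := {z | ∀ g, z.coeff g ≠ 0 → g ∈ M}
  zero_mem' := by simp
  one_mem' := by
    intro g hg
    rw [HahnSeries.coeff_one] at hg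
    by_cases h : g = 0
    · exact h ▸ M.zero_mem
    · simp [h] at hg
  add_mem' := by
    intro y z hy hz g hg
    by_cases h : y.coeff g = 0
    · exact hz g (by simpa [h] using hg)
    · exact hy g h
  neg_mem' := by
    intro y hy g hg
    exact hy g (by simpa using hg)
  mul_mem' := by
    intro y z hy hz g hg
    obtain ⟨a, ha, c, hc, rfl⟩ := Set.mem_add.1 (HahnSeries.support_mul_subset hg)
    exact M.add_mem (hy a ha) (hz c hc)

section SupportSubring

variable {Γ F : Type*} [AddCommGroup Γ] [LinearOrder Γ] [IsOrderedAddMonoid Γ] [Field F]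
  {M : AddSubmonoid Γ}

theorem mem_supportSubring {z : HahnSeries Γ F} :
    z ∈ supportSubring M ↔ ∀ g, z.coeff g ≠ 0 → g ∈ M :=
  Iff.rfl

theorem supportSubring_mono {N : AddSubmonoid Γ} (h : M ≤ N) :
    supportSubring (F := F) M ≤ supportSubring N :=
  fun _ hz g hg => h (hz g hg)

theorem single_mem_supportSubring {g : Γ} (hg : g ∈ M) (a : F) :
    HahnSeries.single g a ∈ supportSubring M := by
  intro k hk
  by_cases h : k = g
  · exact h ▸ hg
  · simp [HahnSeries.coeff_single_of_ne h] at hk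

theorem C_mem_supportSubring (a : F) : HahnSeries.C a ∈ supportSubring M :=
  single_mem_supportSubring M.zero_mem a

theorem one_sub_inv_mem_supportSubring {z : HahnSeries Γ F} (hz : z ∈ supportSubring M)
    (hpos : 0 < z.orderTop) : (1 - z)⁻¹ ∈ supportSubring M := by
  rw [inv_eq_of_mul_eq_one_right (HahnSeries.SummableFamily.one_sub_self_mul_hsum_powers hpos)]
  intro g hg
  rw [HahnSeries.SummableFamily.coeff_hsum] at hg
  obtain ⟨k, hk⟩ : ∃ k, (HahnSeries.SummableFamily.powers z k).coeff g ≠ 0 := by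
    by_contra! h
    exact hg (by simp_rw [h, finsum_zero])
  rw [HahnSeries.SummableFamily.powers_of_orderTop_pos hpos] at hk
  exact pow_mem hz k g hk

theorem one_sub_single_inv_mem_supportSubring {g : Γ} (hg : g ∈ M) (hpos : 0 < g) (a : F) :
    (1 - HahnSeries.single g a)⁻¹ ∈ supportSubring M :=
  one_sub_inv_mem_supportSubring (single_mem_supportSubring hg a)
    (HahnSeries.lt_orderTop_single hpos)

theorem binomial_inv_mem_supportSubring {g k : Γ} (hgk : g < k) (hg : -g ∈ M) (hk : k - g ∈ M)
    (c : F) : (HahnSeries.single g 1 + HahnSeries.single k c)⁻¹ ∈ supportSubring M := by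
  have h : HahnSeries.single g (1 : F) + HahnSeries.single k c =
      HahnSeries.single g 1 * (1 - HahnSeries.single (k - g) (-c)) := by
    rw [mul_sub, mul_one, HahnSeries.single_mul_single]
    simp
  rw [h, mul_inv, HahnSeries.inv_single]
  exact mul_mem (single_mem_supportSubring hg _)
    (one_sub_single_inv_mem_supportSubring hk (sub_pos.2 hgk) _)

theorem binomial_ne_zero {Γ F : Type*} [PartialOrder Γ] [Field F] {g k : Γ} (hgk : g ≠ k) (c : F) :
    HahnSeries.single g 1 + HahnSeries.single k c ≠ 0 := by
  intro h
  have := congrArg (fun z => HahnSeries.coeff z g) h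
  simp [HahnSeries.coeff_single_of_ne hgk] at this

end SupportSubring

/-! ### Iterated Laurent series -/

/-- The degree in `u_m⁻¹` of an exponent vector. -/
def coordDeg {r : ℕ} (m : Fin r) : Lex (Fin r → ℤ) →+ ℤ where
  toFun g := ofLex g (Fin.rev m)
  map_zero' := rfl
  map_add' _ _ := rfl

/-- The variable `u_i` over an arbitrary coefficient field. -/
def laurentVar (F : Type*) [Field F] {r : ℕ} (i : Fin r) : HahnSeries (Lex (Fin r → ℤ)) F :=
  HahnSeries.single (toLex (Pi.single (Fin.rev i) (-1 : ℤ))) 1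

section LaurentVar

variable {F : Type*} [Field F] {r : ℕ}

theorem coordDeg_single_self (m : Fin r) (a : ℤ) :
    coordDeg m (toLex (Pi.single (Fin.rev m) a)) = a :=
  Pi.single_eq_same _ _

theorem coordDeg_single_of_ne {m i : Fin r} (h : m ≠ i) (a : ℤ) :
    coordDeg m (toLex (Pi.single (Fin.rev i) a)) = 0 :=
  Pi.single_eq_of_ne (fun h' => h (Fin.rev_injective h')) _

theorem single_neg_one_lt_zero (i : Fin r) :
    toLex (Pi.single (Fin.rev i) (-1 : ℤ)) < (0 : Lex (Fin r → ℤ)) :=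
  ⟨Fin.rev i, fun j hj => Pi.single_eq_of_ne hj.ne _,
    (by simp : (Pi.single (Fin.rev i) (-1) : Fin r → ℤ) (Fin.rev i) < 0)⟩

theorem single_neg_one_lt_single {i j : Fin r} (h : j < i) :
    (toLex (Pi.single (Fin.rev i) (-1 : ℤ)) : Lex (Fin r → ℤ)) <
      toLex (Pi.single (Fin.rev j) (-1 : ℤ)) := by
  have hr : Fin.rev i < Fin.rev j := Fin.rev_lt_rev.2 h
  refine ⟨Fin.rev i, fun k hk => ?_, ?_⟩
  · simp [Pi.single_eq_of_ne hk.ne, Pi.single_eq_of_ne (hk.trans hr).ne]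
  · simp [Pi.single_eq_of_ne hr.ne]

theorem laurentVar_add_C_ne_zero (i : Fin r) (c : F) : laurentVar F i + HahnSeries.C c ≠ 0 :=
  binomial_ne_zero (single_neg_one_lt_zero i).ne c

theorem laurentVar_sub_C_ne_zero (i : Fin r) (c : F) : laurentVar F i - HahnSeries.C c ≠ 0 := by
  simpa [sub_eq_add_neg] using laurentVar_add_C_ne_zero i (-c)

theorem laurentVar_ne_zero (i : Fin r) : laurentVar F i ≠ 0 := by
  simpa using laurentVar_add_C_ne_zero i (0 : F)

theorem laurentVar_add_ne_zero {i j : Fin r} (h : j < i) :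
    laurentVar F i + laurentVar F j ≠ 0 :=
  binomial_ne_zero (single_neg_one_lt_single h).ne 1

/-- The exponent vectors without `u_m`. -/
abbrev degZero (m : Fin r) : AddSubmonoid (Lex (Fin r → ℤ)) :=
  AddSubmonoid.comap (coordDeg m) ⊥

/-- The exponent vectors whose degree in `u_m` is nonnegative. -/
abbrev degNonpos (m : Fin r) : AddSubmonoid (Lex (Fin r → ℤ)) :=
  AddSubmonoid.comap (-coordDeg m) (AddSubmonoid.nonneg ℤ)

/-- The exponent vectors whose degree in `u_m⁻¹` is nonnegative. -/
abbrev degNonneg (m : Fin r) : AddSubmonoid (Lex (Fin r → ℤ)) :=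
  AddSubmonoid.comap (coordDeg m) (AddSubmonoid.nonneg ℤ)

theorem degZero_le_degNonpos (m : Fin r) : degZero m ≤ degNonpos m := by
  intro g hg
  have : coordDeg m g = 0 := hg
  simp [this]

theorem degZero_le_degNonneg (m : Fin r) : degZero m ≤ degNonneg m := by
  intro g hg
  have : coordDeg m g = 0 := hg
  simp [this]

theorem laurentVar_mem_degZero {m i : Fin r} (h : m < i) :
    laurentVar F i ∈ supportSubring (degZero m) :=
  single_mem_supportSubring (coordDeg_single_of_ne h.ne _) _

theorem laurentVar_mem_degNonpos (m : Fin r) :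
    laurentVar F m ∈ supportSubring (degNonpos m) :=
  single_mem_supportSubring (by simp [coordDeg_single_self]) _

theorem laurentVar_add_C_inv_mem_degZero {m i : Fin r} (h : m < i) (c : F) :
    (laurentVar F i + HahnSeries.C c)⁻¹ ∈ supportSubring (degZero m) := by
  refine binomial_inv_mem_supportSubring (single_neg_one_lt_zero i) ?_ ?_ c <;>
    simp [coordDeg_single_of_ne h.ne]

theorem laurentVar_sub_C_inv_mem_degZero {m i : Fin r} (h : m < i) (c : F) :
    (laurentVar F i - HahnSeries.C c)⁻¹ ∈ supportSubring (degZero m) := by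
  simpa [sub_eq_add_neg] using laurentVar_add_C_inv_mem_degZero h (-c)

theorem laurentVar_add_inv_mem_degZero {m i j : Fin r} (hj : m < j) (h : j < i) :
    (laurentVar F i + laurentVar F j)⁻¹ ∈ supportSubring (degZero m) := by
  refine binomial_inv_mem_supportSubring (single_neg_one_lt_single h) ?_ ?_ 1 <;>
    simp [coordDeg_single_of_ne (hj.trans h).ne, coordDeg_single_of_ne hj.ne]

theorem laurentVar_add_inv_mem_degNonpos {m i : Fin r} (h : m < i) :
    (laurentVar F i + laurentVar F m)⁻¹ ∈ supportSubring (degNonpos m) := by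
  refine binomial_inv_mem_supportSubring (single_neg_one_lt_single h) ?_ ?_ 1 <;>
    simp [coordDeg_single_of_ne h.ne, coordDeg_single_self]

/-- Two series polynomial in `u_m` are congruent modulo `u_m - c`. -/
def CongrPole (m : Fin r) (c : F) (z z' : HahnSeries (Lex (Fin r → ℤ)) F) : Prop :=
  z ∈ supportSubring (degNonpos m) ∧ z' ∈ supportSubring (degNonpos m) ∧
    ∃ s ∈ supportSubring (degNonpos m), z - z' = (laurentVar F m - HahnSeries.C c) * s

namespace CongrPole

variable {m : Fin r} {c : F} {y y' z z' : HahnSeries (Lex (Fin r → ℤ)) F}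

theorem of_mem (hz : z ∈ supportSubring (degZero m)) : CongrPole m c z z :=
  have h := supportSubring_mono (degZero_le_degNonpos m) hz
  ⟨h, h, 0, zero_mem _, by simp⟩

theorem var (m : Fin r) (c : F) : CongrPole m c (laurentVar F m) (HahnSeries.C c) :=
  ⟨laurentVar_mem_degNonpos m, C_mem_supportSubring c, 1, one_mem _, by simp⟩

theorem add (hy : CongrPole m c y y') (hz : CongrPole m c z z') :
    CongrPole m c (y + z) (y' + z') := by
  obtain ⟨h1, h2, s, hs, h⟩ := hy
  obtain ⟨k1, k2, t, ht, k⟩ := hz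
  refine ⟨add_mem h1 k1, add_mem h2 k2, s + t, add_mem hs ht, ?_⟩
  rw [mul_add, ← h, ← k]
  ring

theorem neg (hy : CongrPole m c y y') : CongrPole m c (-y) (-y') := by
  obtain ⟨h1, h2, s, hs, h⟩ := hy
  refine ⟨neg_mem h1, neg_mem h2, -s, neg_mem hs, ?_⟩
  rw [mul_neg, ← h]
  ring

theorem sub (hy : CongrPole m c y y') (hz : CongrPole m c z z') :
    CongrPole m c (y - z) (y' - z') := by
  simpa only [sub_eq_add_neg] using hy.add hz.neg

theorem mul (hy : CongrPole m c y y') (hz : CongrPole m c z z') :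
    CongrPole m c (y * z) (y' * z') := by
  obtain ⟨h1, h2, s, hs, h⟩ := hy
  obtain ⟨k1, k2, t, ht, k⟩ := hz
  refine ⟨mul_mem h1 k1, mul_mem h2 k2, s * z + y' * t,
    add_mem (mul_mem hs k1) (mul_mem h2 ht), ?_⟩
  linear_combination z * h + y' * k

theorem prod {ι : Type*} {X : Finset ι} {y y' : ι → HahnSeries (Lex (Fin r → ℤ)) F}
    (h : ∀ i, CongrPole m c (y i) (y' i)) : CongrPole m c (∏ i ∈ X, y i) (∏ i ∈ X, y' i) := by
  classical
  induction X using Finset.induction_on with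
  | empty => exact of_mem (one_mem _)
  | insert i X hi ih =>
    rw [prod_insert hi, prod_insert hi]
    exact (h i).mul ih

theorem inv (h : CongrPole m c z z') (h1 : z ≠ 0) (h2 : z' ≠ 0)
    (hi1 : z⁻¹ ∈ supportSubring (degNonpos m)) (hi2 : z'⁻¹ ∈ supportSubring (degNonpos m)) :
    CongrPole m c z⁻¹ z'⁻¹ := by
  obtain ⟨-, -, s, hs, h⟩ := h
  refine ⟨hi1, hi2, -(z⁻¹ * z'⁻¹ * s), neg_mem (mul_mem (mul_mem hi1 hi2) hs), ?_⟩
  field_simp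
  linear_combination -h

theorem eval₂ (m : Fin r) (c : F) (f : Polynomial F) :
    CongrPole m c (f.eval₂ HahnSeries.C (laurentVar F m)) (HahnSeries.C (f.eval c)) := by
  induction f using Polynomial.induction_on' with
  | add p q hp hq =>
    rw [Polynomial.eval₂_add, Polynomial.eval_add, map_add]
    exact hp.add hq
  | monomial k a =>
    rw [Polynomial.eval₂_monomial, Polynomial.eval_monomial, map_mul, map_pow]
    refine (of_mem (C_mem_supportSubring a)).mul ?_
    simpa using prod (X := range k) (fun _ : ℕ => var m c)

end CongrPole

/-- Extracting the coefficient of `u_m ^ 0` substitutes the pole `c` for `u_m`. -/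
theorem coeff_zero_pole_mul {m : Fin r} {c : F} {z z' : HahnSeries (Lex (Fin r → ℤ)) F}
    (h : CongrPole m c z z') (hz' : z' ∈ supportSubring (degZero m)) :
    (laurentVar F m / (laurentVar F m - HahnSeries.C c) * z).coeff 0 = z'.coeff 0 := by
  obtain ⟨-, -, s, hs, hzs⟩ := h
  have hne := laurentVar_sub_C_ne_zero m c
  obtain ⟨e, he⟩ : ∃ e : Lex (Fin r → ℤ), e = toLex (Pi.single (Fin.rev m) (-1 : ℤ)) := ⟨_, rfl⟩
  have hdeg : coordDeg m e = -1 := he ▸ coordDeg_single_self m _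
  have hinv : z' * (1 - HahnSeries.single (-e) c)⁻¹ ∈ supportSubring (degNonneg m) :=
    mul_mem (supportSubring_mono (degZero_le_degNonneg m) hz')
      (one_sub_single_inv_mem_supportSubring (by simp [hdeg])
        (neg_pos.2 (he ▸ single_neg_one_lt_zero m)) c)
  have key : laurentVar F m / (laurentVar F m - HahnSeries.C c) * z =
      z' + HahnSeries.single (-e) c * (z' * (1 - HahnSeries.single (-e) c)⁻¹) +
        HahnSeries.single e 1 * s := by
    have h1 : z = z' + (laurentVar F m - HahnSeries.C c) * s := by rw [← hzs]; simp
    have hv : HahnSeries.single e 1 = laurentVar F m := he ▸ rfl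
    have hC : HahnSeries.single (-e) c = HahnSeries.C c / laurentVar F m := by
      rw [← hv, div_eq_mul_inv, HahnSeries.inv_single, HahnSeries.C_apply,
        HahnSeries.single_mul_single]
      simp
    have hv0 : laurentVar F m ≠ 0 := laurentVar_ne_zero m
    rw [h1, hC, hv, one_sub_div hv0]
    field_simp
    ring
  rw [key, HahnSeries.coeff_add, HahnSeries.coeff_add, HahnSeries.coeff_single_mul,
    HahnSeries.coeff_single_mul]
  have e1 : (z' * (1 - HahnSeries.single (-e) c)⁻¹).coeff (0 - -e) = 0 := by
    by_contra hc
    have := mem_supportSubring.1 hinv _ hc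
    simp [hdeg] at this
  have e2 : s.coeff (0 - e) = 0 := by
    by_contra hc
    have := mem_supportSubring.1 hs _ hc
    simp [hdeg] at this
  rw [e1, e2]
  simp

end LaurentVar

/-! ### Partial fractions -/

section PartialFractions

variable {L ι : Type*} [Field L] [DecidableEq ι]

/-- The coefficient of the pole `x k` in the partial fraction expansion of
`∏ j ∈ X, (u + x j) / (u - x j)`. -/
def poleCoeff (x : ι → L) (X : Finset ι) (k : ι) : L :=
  ∏ j ∈ X.erase k, (x k + x j) / (x k - x j)

open Polynomial in
theorem prod_add_sub_prod_sub (x : ι → L) (X : Finset ι) (hinj : Set.InjOn x X)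
    (h0 : ∀ k ∈ X, x k ≠ 0) (u : L) :
    ∏ k ∈ X, (u + x k) - (-1) ^ #X * ∏ k ∈ X, (u - x k) =
      ∑ k ∈ X, 2 * poleCoeff x X k * u * ∏ j ∈ X.erase k, (u - x j) := by
  classical
  have key : ∏ k ∈ X, (Polynomial.X + C (x k)) -
      C ((-1) ^ #X) * ∏ k ∈ X, (Polynomial.X - C (x k)) =
      ∑ k ∈ X, C (2 * poleCoeff x X k) *
        (Polynomial.X * ∏ j ∈ X.erase k, (Polynomial.X - C (x j))) := by
    have hmem : (0 : L) ∉ X.image x := by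
      simp only [mem_image, not_exists, not_and]
      exact fun k hk h => h0 k hk h
    have hcard : #(insert 0 (X.image x)) = #X + 1 := by
      rw [card_insert_of_notMem hmem, card_image_of_injOn hinj]
    refine Polynomial.eq_of_degrees_lt_of_eval_finset_eq (insert 0 (X.image x)) ?_ ?_ ?_
    · rw [hcard, ← mem_degreeLT]
      refine Submodule.sub_mem _ ?_ ?_
      · rw [mem_degreeLT, degree_prod]
        simp only [degree_X_add_C, sum_const, nsmul_eq_mul, mul_one]
        exact_mod_cast Nat.lt_succ_self _
      · rw [← smul_eq_C_mul]
        refine Submodule.smul_mem _ _ ?_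
        rw [mem_degreeLT, degree_prod]
        simp only [degree_X_sub_C, sum_const, nsmul_eq_mul, mul_one]
        exact_mod_cast Nat.lt_succ_self _
    · rw [hcard, ← mem_degreeLT]
      refine Submodule.sum_mem _ fun k hk => ?_
      rw [← smul_eq_C_mul]
      refine Submodule.smul_mem _ _ ?_
      rw [mem_degreeLT, degree_mul, degree_prod]
      simp only [degree_X_sub_C, degree_X, sum_const, nsmul_eq_mul, mul_one]
      have := card_erase_add_one hk
      rw [add_comm]
      exact_mod_cast (this.le.trans_lt (Nat.lt_succ_self _))
    · intro y hy
      rcases mem_insert.1 hy with rfl | hy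
      · simp [eval_prod, eval_finsetSum, prod_neg, ← mul_assoc, ← mul_pow]
      · obtain ⟨k, hk, rfl⟩ := mem_image.1 hy
        have hz : ∏ j ∈ X, (x k - x j) = 0 := prod_eq_zero hk (sub_self _)
        have hne : ∏ j ∈ X.erase k, (x k - x j) ≠ 0 := by
          refine prod_ne_zero_iff.2 fun j hj => sub_ne_zero.2 fun h => ?_
          exact (mem_erase.1 hj).1 (hinj (mem_erase.1 hj).2 hk h.symm)
        simp only [eval_sub, eval_prod, eval_add, eval_X, eval_C, eval_mul, eval_finsetSum, hz,
          mul_zero, sub_zero]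
        rw [sum_eq_single_of_mem k hk, poleCoeff, prod_div_distrib, ← mul_prod_erase X _ hk]
        · field_simp
          ring
        · intro l _ hlk
          rw [prod_eq_zero (mem_erase.2 ⟨hlk.symm, hk⟩) (sub_self (x k)), mul_zero, mul_zero]
  have := congrArg (eval u) key
  simpa [eval_prod, eval_finsetSum, mul_assoc] using this

theorem half_prod_div_sub_sign (x : ι → L) (X : Finset ι) (hinj : Set.InjOn x X)
    (h0 : ∀ k ∈ X, x k ≠ 0) (h2 : (2 : L) ≠ 0) (u : L) (hu : ∀ k ∈ X, u - x k ≠ 0) :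
    2⁻¹ * (∏ k ∈ X, (u + x k) / (u - x k) - (-1) ^ #X) =
      ∑ k ∈ X, poleCoeff x X k * (u / (u - x k)) := by
  have hne : ∏ k ∈ X, (u - x k) ≠ 0 := prod_ne_zero_iff.2 hu
  have hsum : ∑ k ∈ X, 2 * poleCoeff x X k * u * ∏ j ∈ X.erase k, (u - x j) =
      2 * (∏ k ∈ X, (u - x k)) * ∑ k ∈ X, poleCoeff x X k * (u / (u - x k)) := by
    rw [mul_sum]
    refine sum_congr rfl fun k hk => ?_
    have := hu k hk
    rw [← mul_prod_erase X (fun j => u - x j) hk]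
    field_simp
  rw [prod_div_distrib, div_sub' hne, mul_comm (∏ k ∈ X, (u - x k)),
    prod_add_sub_prod_sub x X hinj h0 u, hsum]
  field_simp

end PartialFractions

/-! ### Triangular products -/

/-- The product `∏ i, h * (y i * ∏ j < i, ρ i j - (-1) ^ i * s) * g i`. -/
def towerProd {R : Type*} [CommRing R] {t : ℕ} (h s : R) (y g : Fin t → R)
    (ρ : Fin t → Fin t → R) : R :=
  ∏ i, h * (y i * ∏ j ∈ Iio i, ρ i j - (-1) ^ (i : ℕ) * s) * g i

theorem towerProd_succ {R : Type*} [CommRing R] {t : ℕ} (h s : R) (y g : Fin (t + 1) → R)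
    (ρ : Fin (t + 1) → Fin (t + 1) → R) :
    towerProd h s y g ρ = h * (y 0 - s) * g 0 *
      towerProd h (-s) (fun i => y i.succ * ρ i.succ 0) (fun i => g i.succ)
        (fun i j => ρ i.succ j.succ) := by
  unfold towerProd
  rw [Fin.prod_univ_succ]
  congr 1
  · have h0 : Iio (0 : Fin (t + 1)) = ∅ := by ext; simp
    simp [h0]
  · refine prod_congr rfl fun i _ => ?_
    have hI : Iio i.succ = insert 0 ((Iio i).map (Fin.succEmb t)) := by
      ext j
      refine Fin.cases ?_ (fun j => ?_) j <;> simp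
    rw [hI, prod_insert (by simp), prod_map]
    simp only [Fin.coe_succEmb, Fin.val_succ, pow_succ]
    ring

theorem towerProd_mem {R : Type*} [CommRing R] {t : ℕ} (S : Subring R) {h s : R}
    {y g : Fin t → R} {ρ : Fin t → Fin t → R} (hh : h ∈ S) (hs : s ∈ S) (hy : ∀ i, y i ∈ S)
    (hg : ∀ i, g i ∈ S) (hρ : ∀ i j, j < i → ρ i j ∈ S) : towerProd h s y g ρ ∈ S :=
  prod_mem fun i _ => mul_mem (mul_mem hh (sub_mem
    (mul_mem (hy i) (prod_mem fun j hj => hρ i j (mem_Iio.1 hj)))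
    (mul_mem (pow_mem (neg_mem (one_mem _)) _) hs))) (hg i)

/-! ### Sums over injective sequences -/

section InjectiveSum

variable {F ι : Type*} [Field F] [Fintype ι] [DecidableEq ι]

/-- The injective sequences of length `t` in `X`. -/
def injSeqs (t : ℕ) (X : Finset ι) : Finset (Fin t → ι) :=
  open Classical in univ.filter fun e => Function.Injective e ∧ ∀ i, e i ∈ X

/-- The symmetrized sum
`∑ e, ∏ i, f_i(x_{e i}) ∏_{j ∈ X, j ∉ {e 0, …, e i}} (x_{e i} + x_j) / (x_{e i} - x_j)`. -/
def injSum (x : ι → F) {t : ℕ} (X : Finset ι) (f : Fin t → Polynomial F) : F :=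
  ∑ e ∈ injSeqs t X, ∏ i, (f i).eval (x (e i)) *
    ∏ j ∈ X \ (Iic i).image e, (x (e i) + x j) / (x (e i) - x j)

theorem injSum_zero (x : ι → F) (X : Finset ι) (f : Fin 0 → Polynomial F) :
    injSum x X f = 1 := by
  have : injSeqs 0 X = {Fin.elim0} := by
    ext e
    simp [injSeqs, Function.injective_of_subsingleton, eq_iff_true_of_subsingleton]
  simp [injSum, this]

theorem injSum_succ (x : ι → F) {t : ℕ} (X : Finset ι) (f : Fin (t + 1) → Polynomial F) :
    injSum x X f = ∑ k ∈ X, poleCoeff x X k * ((f 0).eval (x k)) *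
      injSum x (X.erase k) (fun i => f i.succ) := by
  simp only [injSum, mul_sum]
  rw [sum_sigma']
  symm
  refine sum_bij' (fun p _ => Fin.cons p.1 p.2) (fun e _ => ⟨e 0, Fin.tail e⟩) ?_ ?_ ?_ ?_ ?_
  · rintro ⟨k, e⟩ h
    simp only [mem_sigma, injSeqs, mem_filter, mem_univ, true_and, mem_erase] at h ⊢
    obtain ⟨hk, he, hm⟩ := h
    refine ⟨Fin.cons_injective_iff.2 ⟨?_, he⟩, Fin.cases (by simpa using hk) ?_⟩
    · rintro ⟨i, hi⟩
      exact (hm i).1 hi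
    · intro i
      simpa using (hm i).2
  · intro e h
    simp only [mem_sigma, injSeqs, mem_filter, mem_univ, true_and, mem_erase] at h ⊢
    refine ⟨h.2 0, h.1.comp (Fin.succ_injective t), fun i => ⟨fun hi => ?_, h.2 i.succ⟩⟩
    exact Fin.succ_ne_zero i (h.1 hi)
  · rintro ⟨k, e⟩ _
    simp
  · intro e _
    simp
  · rintro ⟨k, e⟩ h
    rw [Fin.prod_univ_succ]
    have h0 : X \ (Iic (0 : Fin (t + 1))).image (Fin.cons k e : Fin (t + 1) → ι) = X.erase k := by
      have : Iic (0 : Fin (t + 1)) = {0} := by ext; simp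
      rw [this, image_singleton, Fin.cons_zero, sdiff_singleton_eq_erase]
    have hs : ∀ i : Fin t, X \ (Iic i.succ).image (Fin.cons k e : Fin (t + 1) → ι) =
        X.erase k \ (Iic i).image e := by
      intro i
      have : Iic i.succ = insert 0 ((Iic i).map (Fin.succEmb t)) := by
        ext j
        refine Fin.cases ?_ (fun j => ?_) j <;> simp
      rw [this, image_insert, map_eq_image, image_image]
      ext j
      simp only [Fin.cons_zero, mem_sdiff, mem_insert, mem_image, mem_erase, Function.comp,
        Fin.coe_succEmb, Fin.cons_succ]
      rw [not_or]
      exact ⟨fun h => ⟨⟨h.2.1, h.1⟩, h.2.2⟩, fun h => ⟨h.1.2, h.1.1, h.2⟩⟩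
    simp only [Fin.cons_zero, Fin.cons_succ, h0, hs, poleCoeff]
    ring

end InjectiveSum

/-! ### The constant term -/

section ConstantTerm

variable {F : Type*} [Field F] {r : ℕ}

theorem C_mul_coeff (a : F) (z : HahnSeries (Lex (Fin r → ℤ)) F) (g : Lex (Fin r → ℤ)) :
    (HahnSeries.C a * z).coeff g = a * z.coeff g := by
  rw [HahnSeries.C_mul_eq_smul, HahnSeries.coeff_smul, smul_eq_mul]

theorem eval₂_mem_supportSubring {M : AddSubmonoid (Lex (Fin r → ℤ))}
    {z : HahnSeries (Lex (Fin r → ℤ)) F} (hz : z ∈ supportSubring M) (f : Polynomial F) :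
    f.eval₂ HahnSeries.C z ∈ supportSubring M := by
  rw [Polynomial.eval₂_eq_sum_range]
  exact sum_mem fun i _ => mul_mem (C_mem_supportSubring _) (pow_mem hz i)

theorem two_inv_mem_supportSubring (M : AddSubmonoid (Lex (Fin r → ℤ))) :
    (2 : HahnSeries (Lex (Fin r → ℤ)) F)⁻¹ ∈ supportSubring M := by
  have := C_mem_supportSubring (M := M) (2⁻¹ : F)
  rwa [map_inv₀, map_ofNat] at this

theorem laurentVar_ratio_mem_degZero {m i j : Fin r} (hj : m < j) (h : j < i) :
    (laurentVar F i - laurentVar F j) / (laurentVar F i + laurentVar F j) ∈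
      supportSubring (degZero m) := by
  rw [div_eq_mul_inv]
  exact mul_mem (sub_mem (laurentVar_mem_degZero (hj.trans h)) (laurentVar_mem_degZero hj))
    (laurentVar_add_inv_mem_degZero hj h)

theorem laurentVar_ratio_C_mem_degZero {m i : Fin r} (h : m < i) (c : F) :
    (laurentVar F i - HahnSeries.C c) / (laurentVar F i + HahnSeries.C c) ∈
      supportSubring (degZero m) := by
  rw [div_eq_mul_inv]
  exact mul_mem (sub_mem (laurentVar_mem_degZero h) (C_mem_supportSubring c))
    (laurentVar_add_C_inv_mem_degZero h c)

theorem CongrPole.laurentVar_ratio {m i : Fin r} (h : m < i) (c : F) :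
    CongrPole m c ((laurentVar F i - laurentVar F m) / (laurentVar F i + laurentVar F m))
      ((laurentVar F i - HahnSeries.C c) / (laurentVar F i + HahnSeries.C c)) := by
  rw [div_eq_mul_inv, div_eq_mul_inv]
  have hi := CongrPole.of_mem (c := c) (laurentVar_mem_degZero (F := F) h)
  exact (hi.sub (var m c)).mul ((hi.add (var m c)).inv (laurentVar_add_ne_zero h)
    (laurentVar_add_C_ne_zero i c) (laurentVar_add_inv_mem_degNonpos h)
    (supportSubring_mono (degZero_le_degNonpos m) (laurentVar_add_C_inv_mem_degZero h c)))

theorem CongrPole.towerProd {t : ℕ} {m : Fin r} {c : F} {h s : HahnSeries (Lex (Fin r → ℤ)) F}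
    {y y' g : Fin t → HahnSeries (Lex (Fin r → ℤ)) F}
    {ρ : Fin t → Fin t → HahnSeries (Lex (Fin r → ℤ)) F}
    (hh : h ∈ supportSubring (degZero m)) (hs : s ∈ supportSubring (degZero m))
    (hy : ∀ i, CongrPole m c (y i) (y' i)) (hg : ∀ i, g i ∈ supportSubring (degZero m))
    (hρ : ∀ i j, j < i → ρ i j ∈ supportSubring (degZero m)) :
    CongrPole m c (towerProd h s y g ρ) (towerProd h s y' g ρ) :=
  CongrPole.prod fun i => ((of_mem hh).mul (((hy i).mul
    (of_mem (prod_mem fun j hj => hρ i j (mem_Iio.1 hj)))).sub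
      (of_mem (mul_mem (pow_mem (neg_mem (one_mem _)) _) hs)))).mul (of_mem (hg i))

/-- The constant term of the generating function, with arbitrary polynomials `f_i` in place of
the factorial powers. -/
theorem coeff_zero_towerProd {ι : Type*} [Fintype ι] [DecidableEq ι] (h2 : (2 : F) ≠ 0)
    {x : ι → F} (hinj : Function.Injective x) (h0 : ∀ k, x k ≠ 0) {t : ℕ} (v : Fin t → Fin r)
    (hv : StrictMono v) (X : Finset ι) (f : Fin t → Polynomial F) :
    (towerProd 2⁻¹ ((-1) ^ #X)
      (fun i => ∏ k ∈ X, (laurentVar F (v i) + HahnSeries.C (x k)) /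
        (laurentVar F (v i) - HahnSeries.C (x k)))
      (fun i => (f i).eval₂ HahnSeries.C (laurentVar F (v i)))
      (fun i j => (laurentVar F (v i) - laurentVar F (v j)) /
        (laurentVar F (v i) + laurentVar F (v j)))).coeff 0 = injSum x X f := by
  induction t generalizing X with
  | zero => simp [towerProd, injSum_zero]
  | succ t ih =>
    have h2' : (2 : HahnSeries (Lex (Fin r → ℤ)) F) ≠ 0 := by
      rw [← map_ofNat (HahnSeries.C : F →+* HahnSeries (Lex (Fin r → ℤ)) F)]
      exact (map_ne_zero _).2 h2
    rw [towerProd_succ, half_prod_div_sub_sign (fun k => HahnSeries.C (x k)) X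
      (fun a _ c _ h => hinj (HahnSeries.C_injective h)) (fun k _ => (map_ne_zero _).2 (h0 k)) h2' _
      (fun k _ => laurentVar_sub_C_ne_zero _ _), sum_mul, sum_mul, HahnSeries.coeff_sum,
      injSum_succ]
    refine sum_congr rfl fun k hk => ?_
    have hpole : poleCoeff (fun k => HahnSeries.C (x k)) X k =
        (HahnSeries.C (poleCoeff x X k) : HahnSeries (Lex (Fin r → ℤ)) F) := by
      simp [poleCoeff, map_prod, map_div₀]
    have hm : ∀ i : Fin t, v 0 < v i.succ := fun i => hv (Fin.succ_pos i)
    have hv' : StrictMono fun i : Fin t => v i.succ := hv.comp (Fin.strictMono_succ)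
    have hs : (-(-1) ^ #X : HahnSeries (Lex (Fin r → ℤ)) F) ∈ supportSubring (degZero (v 0)) :=
      neg_mem (pow_mem (neg_mem (one_mem _)) _)
    have hy : ∀ i : Fin t, ∏ k ∈ X, (laurentVar F (v i.succ) + HahnSeries.C (x k)) /
        (laurentVar F (v i.succ) - HahnSeries.C (x k)) ∈ supportSubring (degZero (v 0)) :=
      fun i => prod_mem fun k _ => by
        rw [div_eq_mul_inv]
        exact mul_mem (add_mem (laurentVar_mem_degZero (hm i)) (C_mem_supportSubring _))
          (laurentVar_sub_C_inv_mem_degZero (hm i) _)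
    have hg := fun i : Fin t =>
      eval₂_mem_supportSubring (laurentVar_mem_degZero (F := F) (hm i)) (f i.succ)
    have hρ := fun (i j : Fin t) (hij : j < i) =>
      laurentVar_ratio_mem_degZero (F := F) (hm j) (hv' hij)
    have hD := (CongrPole.eval₂ (v 0) (x k) (f 0)).mul
      (CongrPole.towerProd (two_inv_mem_supportSubring _) hs
        (fun i => (CongrPole.of_mem (hy i)).mul (CongrPole.laurentVar_ratio (hm i) (x k))) hg hρ)
    have hS := mul_mem (C_mem_supportSubring ((f 0).eval (x k)))
      (towerProd_mem _ (two_inv_mem_supportSubring _) hs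
        (fun i => mul_mem (hy i) (laurentVar_ratio_C_mem_degZero (hm i) (x k))) hg hρ)
    rw [hpole, mul_assoc, mul_assoc, C_mul_coeff, coeff_zero_pole_mul hD hS, C_mul_coeff,
      ← ih _ hv' (X.erase k), ← mul_assoc]
    congr 3
    have hsign : -(-1 : HahnSeries (Lex (Fin r → ℤ)) F) ^ #X = (-1) ^ #(X.erase k) := by
      rw [← card_erase_add_one hk, pow_succ]
      ring
    · exact hsign
    · funext i
      have e1 := laurentVar_sub_C_ne_zero (v i.succ) (x k)
      have e2 := laurentVar_add_C_ne_zero (v i.succ) (x k)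
      rw [← mul_prod_erase X _ hk]
      field_simp

end ConstantTerm

/-! ### Coset representatives -/

theorem Cperm_ext {r n : ℕ} (hrn : r ≤ n) {w w' : Equiv.Perm (Fin n)} (hw : w ∈ Cperm r n)
    (hw' : w' ∈ Cperm r n) (h : ∀ i : Fin r, w (Fin.castLE hrn i) = w' (Fin.castLE hrn i)) :
    w = w' := by
  obtain ⟨d, rfl⟩ := Nat.exists_eq_add_of_le hrn
  simp only [Cperm, mem_filter, mem_univ, true_and] at hw hw'
  have mono : ∀ v : Equiv.Perm (Fin (r + d)),
      (∀ i j : Fin (r + d), r ≤ (i : ℕ) → i < j → v i < v j) →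
        StrictMono fun k : Fin d => v (Fin.natAdd r k) := fun v hv k l hkl =>
    hv _ _ (by simp) ((Fin.strictMono_natAdd r) hkl)
  have hinj : Function.Injective fun i : Fin r => w (Fin.castAdd d i) :=
    w.injective.comp (Fin.castAdd_injective r d)
  have hcard : #(univ \ univ.image fun i : Fin r => w (Fin.castAdd d i)) = d := by
    rw [card_sdiff_of_subset (subset_univ _), card_image_of_injective _ hinj]
    simp
  have hmem : ∀ v : Equiv.Perm (Fin (r + d)), (∀ i : Fin r, w (Fin.castAdd d i) =
      v (Fin.castAdd d i)) → ∀ k : Fin d, v (Fin.natAdd r k) ∈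
        univ \ univ.image fun i : Fin r => w (Fin.castAdd d i) := by
    intro v hv k
    simp only [mem_sdiff, mem_univ, mem_image, true_and, not_exists]
    intro i hi
    rw [hv i] at hi
    have := congrArg Fin.val (v.injective hi)
    have hi' := i.isLt
    simp at this
    omega
  have h1 := orderEmbOfFin_unique hcard (hmem w fun _ => rfl) (mono w hw)
  have h2 := orderEmbOfFin_unique hcard (hmem w' h) (mono w' hw')
  ext1 i
  refine Fin.addCases (fun i => h i) (fun k => ?_) i
  exact congrFun (h1.trans h2.symm) k

theorem exists_mem_Cperm {r n : ℕ} (hrn : r ≤ n) {e : Fin r → Fin n}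
    (he : Function.Injective e) :
    ∃ w ∈ Cperm r n, ∀ i : Fin r, w (Fin.castLE hrn i) = e i := by
  obtain ⟨d, rfl⟩ := Nat.exists_eq_add_of_le hrn
  have hcard : #(univ \ univ.image e) = d := by
    rw [card_sdiff_of_subset (subset_univ _), card_image_of_injective _ he]
    simp
  let w : Fin (r + d) → Fin (r + d) :=
    Fin.addCases e ((univ \ univ.image e).orderEmbOfFin hcard)
  have hl : ∀ i, w (Fin.castAdd d i) = e i := fun i => Fin.addCases_left i
  have hr : ∀ k, w (Fin.natAdd r k) = (univ \ univ.image e).orderEmbOfFin hcard k :=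
    fun k => Fin.addCases_right k
  have hdisj : ∀ i k, e i ≠ (univ \ univ.image e).orderEmbOfFin hcard k := by
    intro i k h
    have := (univ \ univ.image e).orderEmbOfFin_mem hcard k
    rw [← h] at this
    simp at this
  have hinj : Function.Injective w := by
    intro a c
    refine Fin.addCases (fun i => ?_) (fun k => ?_) a <;>
      refine Fin.addCases (fun j => ?_) (fun l => ?_) c <;>
        simp only [hl, hr] <;> intro h
    · rw [he h]
    · exact absurd h (hdisj _ _)
    · exact absurd h.symm (hdisj _ _)
    · rw [((univ \ univ.image e).orderEmbOfFin hcard).injective h]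
  refine ⟨Equiv.ofBijective w (Finite.injective_iff_bijective.1 hinj), ?_, hl⟩
  simp only [Cperm, mem_filter, mem_univ, true_and, Equiv.ofBijective_apply]
  intro a c
  refine Fin.addCases (fun i => ?_) (fun k => ?_) a
  · intro h
    have := i.isLt
    simp at h
    omega
  · refine Fin.addCases (fun j => ?_) (fun l => ?_) c
    · intro _ h
      have := j.isLt
      have h' : r + (k : ℕ) < j := h
      omega
    · intro _ h
      rw [hr, hr]
      exact ((univ \ univ.image e).orderEmbOfFin hcard).strictMono (by simpa using h)

theorem sum_Cperm {r n : ℕ} (hrn : r ≤ n) {M : Type*} [AddCommMonoid M]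
    (g : (Fin r → Fin n) → M) :
    ∑ w ∈ Cperm r n, g (fun i => w (Fin.castLE hrn i)) = ∑ e ∈ injSeqs r univ, g e := by
  refine sum_bij (fun w _ i => w (Fin.castLE hrn i)) (fun w _ => ?_) (fun w hw w' hw' h => ?_)
    (fun e he => ?_) fun _ _ => rfl
  · simp only [injSeqs, mem_filter, mem_univ, implies_true, and_true, true_and]
    exact w.injective.comp (Fin.castLE_injective hrn)
  · exact Cperm_ext hrn hw hw' (congrFun h)
  · simp only [injSeqs, mem_filter, mem_univ, implies_true, and_true, true_and] at he
    obtain ⟨w, hw, h⟩ := exists_mem_Cperm hrn he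
    exact ⟨w, hw, funext h⟩

theorem prod_Ioi_castLE {r n : ℕ} (hrn : r ≤ n) {M : Type*} [CommMonoid M]
    (w : Equiv.Perm (Fin n)) (i : Fin r) (g : Fin n → M) :
    ∏ j ∈ Ioi (Fin.castLE hrn i), g (w j) =
      ∏ j ∈ univ \ (Iic i).image (fun i => w (Fin.castLE hrn i)), g j := by
  have : univ \ (Iic i).image (fun i => w (Fin.castLE hrn i)) =
      (Ioi (Fin.castLE hrn i)).map w.toEmbedding := by
    ext j
    obtain ⟨k, rfl⟩ := w.surjective j
    simp only [mem_sdiff, mem_univ, true_and, mem_image, mem_Iic, EmbeddingLike.apply_eq_iff_eq,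
      mem_map, mem_Ioi, Equiv.coe_toEmbedding, exists_eq_right, not_exists, not_and]
    constructor
    · intro h
      by_contra! hk
      have hk' : (k : ℕ) ≤ i := hk
      exact h ⟨k, hk'.trans_lt i.isLt⟩ hk' (Fin.ext rfl)
    · rintro h a ha rfl
      exact absurd ha (not_le.2 h)
  rw [this, prod_map]
  rfl

/-! ### The generating function -/

theorem prod_single_one {Γ F ι : Type*} [AddCommGroup Γ] [LinearOrder Γ] [IsOrderedAddMonoid Γ]
    [Field F] (s : Finset ι) (a : ι → Γ) :
    ∏ i ∈ s, HahnSeries.single (a i) (1 : F) = HahnSeries.single (∑ i ∈ s, a i) 1 := by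
  classical
  induction s using Finset.induction_on with
  | empty => rfl
  | insert i s hi ih =>
    rw [prod_insert hi, sum_insert hi, ih, HahnSeries.single_mul_single, mul_one]

theorem prod_laurentVar_pow_inv {F : Type*} [Field F] {r : ℕ} (nu : Fin r → ℕ) :
    ∏ i, (laurentVar F i ^ nu i)⁻¹ =
      HahnSeries.single (toLex fun k : Fin r => (nu (Fin.rev k) : ℤ)) 1 := by
  simp only [laurentVar, HahnSeries.single_pow, HahnSeries.inv_single, one_pow, inv_one,
    prod_single_one]
  refine congrArg (HahnSeries.single · (1 : F)) (ofLex.injective (funext fun k => ?_))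
  change (∑ i, -(nu i • Pi.single (Fin.rev i) (-1 : ℤ)) : Fin r → ℤ) k =
    (nu (Fin.rev k) : ℤ)
  rw [Finset.sum_apply, sum_eq_single (Fin.rev k)]
  · simp
  · intro i _ hi
    have : k ≠ Fin.rev i := fun h => hi (by rw [h, Fin.rev_rev])
    simp [this]
  · simp

theorem prod_prod_Ioi {M : Type*} [CommMonoid M] {r : ℕ} (g : Fin r → Fin r → M) :
    ∏ i, ∏ j ∈ Ioi i, g j i = ∏ i, ∏ j ∈ Iio i, g i j :=
  prod_comm' (by simp)

theorem laurentVar_sub_ne_zero {F : Type*} [Field F] {r : ℕ} {i j : Fin r} (h : j < i) :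
    laurentVar F i - laurentVar F j ≠ 0 := by
  have := binomial_ne_zero (F := F) (single_neg_one_lt_single h).ne (-1)
  rwa [HahnSeries.single_neg, ← sub_eq_add_neg] at this

theorem generating_function_eq_towerProd {F : Type*} [Field F] {n r : ℕ} (x : Fin n → F)
    (b : ℕ → F) (nu : Fin r → ℕ) :
    (∏ i : Fin r,
        (2 : HahnSeries (Lex (Fin r → ℤ)) F)⁻¹ *
          ((∏ j : Fin n, (laurentVar F i + HahnSeries.C (x j)) /
              (laurentVar F i - HahnSeries.C (x j))) -
           (-1) ^ n * ∏ j ∈ Iio i, (laurentVar F i + laurentVar F j) /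
              (laurentVar F j - laurentVar F i))) *
      (∏ i : Fin r, ∏ j ∈ Ioi i, (laurentVar F j - laurentVar F i) /
        (laurentVar F j + laurentVar F i)) *
      (∏ i : Fin r, ∏ j ∈ range (nu i),
          (laurentVar F i + HahnSeries.C (b j)) / laurentVar F i) =
    towerProd 2⁻¹ ((-1) ^ n)
      (fun i => ∏ k, (laurentVar F i + HahnSeries.C (x k)) /
        (laurentVar F i - HahnSeries.C (x k)))
      (fun i => (∏ j ∈ range (nu i), (Polynomial.X + Polynomial.C (b j))).eval₂ HahnSeries.C
        (laurentVar F i))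
      (fun i j => (laurentVar F i - laurentVar F j) / (laurentVar F i + laurentVar F j)) *
    HahnSeries.single (toLex fun k : Fin r => (nu (Fin.rev k) : ℤ)) 1 := by
  rw [prod_prod_Ioi fun i j => (laurentVar F i - laurentVar F j) /
    (laurentVar F i + laurentVar F j), ← prod_laurentVar_pow_inv, towerProd, ← prod_mul_distrib,
    ← prod_mul_distrib, ← prod_mul_distrib]
  refine prod_congr rfl fun i _ => ?_
  have hsign : (∏ j ∈ Iio i, (laurentVar F i + laurentVar F j) /
      (laurentVar F j - laurentVar F i)) * ∏ j ∈ Iio i, (laurentVar F i - laurentVar F j) /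
        (laurentVar F i + laurentVar F j) = (-1) ^ (i : ℕ) := by
    rw [← prod_mul_distrib, ← Fin.card_Iio i, ← prod_const]
    refine prod_congr rfl fun j hj => ?_
    have h1 := laurentVar_add_ne_zero (F := F) (mem_Iio.1 hj)
    have h2 := laurentVar_sub_ne_zero (F := F) (mem_Iio.1 hj)
    have h3 : laurentVar F j - laurentVar F i ≠ 0 := by
      rw [← neg_sub]
      exact neg_ne_zero.2 h2
    field_simp
    ring
  rw [Polynomial.eval₂_finsetProd, prod_div_distrib (s := range (nu i)), prod_const, card_range,
    ← hsign]
  simp only [Polynomial.eval₂_add, Polynomial.eval₂_X, Polynomial.eval₂_C]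
  ring

/-- **Generating function for the factorial Schur `P`-polynomials
(additive specialization of the universal factorial Schur `P`-functions).**

For a strict partition `ν_1 > ⋯ > ν_r > 0` of length `r ≤ n`,
`P_ν(x_n|b) = Σ_{w∈C(r,n)} w·( ∏_i ∏_{j=1}^{ν_i} (x_i+b_j)
  · ∏_i ∏_{j=i+1}^n (x_i+x_j)/(x_i−x_j) )`
equals the coefficient of `u_1^{−ν_1}⋯u_r^{−ν_r}` in
`∏_i (1/2)·( ∏_{j=1}^n (u_i+x_j)/(u_i−x_j) − (−1)^n ∏_{j=1}^{i−1} (u_i+u_j)/(u_j−u_i) )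
  · ∏_{1≤i<j≤r} (u_j−u_i)/(u_j+u_i) · ∏_i ∏_{j=1}^{ν_i} (u_i+b_j)/u_i`. -/
theorem factorial_schur_P_generating_function
    (n r : ℕ) (hr : 1 ≤ r) (hrn : r ≤ n)
    (nu : Fin r → ℕ) (hpos : ∀ i, 0 < nu i)
    (hstrict : ∀ i j : Fin r, i < j → nu j < nu i) :
    (∑ w ∈ Cperm r n,
      (∏ i : Fin r, ∏ j ∈ Finset.range (nu i), (x n (w (Fin.castLE hrn i)) + b n j)) *
      (∏ i : Fin r, ∏ j ∈ Finset.Ioi (Fin.castLE hrn i),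
          (x n (w (Fin.castLE hrn i)) + x n (w j)) /
          (x n (w (Fin.castLE hrn i)) - x n (w j))))
    =
    ((∏ i : Fin r,
        (2 : H n r)⁻¹ *
          ((∏ j : Fin n,
              (u n r i + HahnSeries.C (x n j)) / (u n r i - HahnSeries.C (x n j))) -
           (-1 : H n r) ^ n *
             ∏ j ∈ Finset.Iio i, (u n r i + u n r j) / (u n r j - u n r i))) *
      (∏ i : Fin r, ∏ j ∈ Finset.Ioi i, (u n r j - u n r i) / (u n r j + u n r i)) *
      (∏ i : Fin r, ∏ j ∈ Finset.range (nu i),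
          (u n r i + HahnSeries.C (b n j)) / u n r i)).coeff
        (toLex (fun k : Fin r => (nu (Fin.rev k) : ℤ))) := by
  have h2 : (2 : K n) ≠ 0 := two_ne_zero
  have hinj : Function.Injective (x n) := fun i j h =>
    Sum.inl_injective (MvPolynomial.X_injective (IsFractionRing.injective _ (K n) h))
  have h0 : ∀ k, x n k ≠ 0 := fun k h => MvPolynomial.X_ne_zero (R := ℚ) (Sum.inl k)
    (IsFractionRing.injective _ (K n) (h.trans (map_zero _).symm))
  have key := coeff_zero_towerProd h2 hinj h0 id strictMono_id univ
    fun i : Fin r => ∏ j ∈ range (nu i), (Polynomial.X + Polynomial.C (b n j))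
  rw [card_univ, Fintype.card_fin] at key
  refine Eq.trans ?_ (congrArg (fun z => HahnSeries.coeff z _)
    (generating_function_eq_towerProd (x n) (b n) nu)).symm
  rw [HahnSeries.coeff_mul_single, sub_self, mul_one]
  refine Eq.trans ?_ key.symm
  rw [injSum, ← sum_Cperm hrn]
  refine sum_congr rfl fun w _ => ?_
  rw [← prod_mul_distrib]
  refine prod_congr rfl fun i _ => ?_
  rw [← prod_Ioi_castLE hrn w i fun j => (x n (w (Fin.castLE hrn i)) + x n j) /
    (x n (w (Fin.castLE hrn i)) - x n j)]
  simp [Polynomial.eval_prod]
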